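/- arXiv:0911.1989 — 5 statements merged into one kernel-verified Lean document; each statement's English description precedes it below -/
import Mathlib

section
/- A finite nonempty lattice M, considered as a B₁-module, is projective if and only if it is distributive. Here M is projective means: for all B₁-modules N₁, N₂, every surjective morphism of B₁-modules ψ : N₁ → N₂, and every morphism φ : M → N₂, there exists a morphism ρ : M → N₁ with ψ ∘ ρ = φ. -/
/-- If the join map `Finset M → M` has a join-preserving section, then `M` is distributive. -/
theorem inf_sup_eq_of_finset_sup_section {M : Type*} [Lattice M] [OrderBot M] [DecidableEq M]
    (ρ : M → Finset M) (hρ : ∀ a b, ρ (a ⊔ b) = ρ a ⊔ ρ b) (hsec : ∀ a, (ρ a).sup id = a)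
    (a b c : M) : a ⊓ (b ⊔ c) = (a ⊓ b) ⊔ (a ⊓ c) := by
  refine le_antisymm ?_ le_inf_sup
  have le_of_mem : ∀ {x y : M}, x ∈ ρ y → x ≤ y := fun {x y} hx =>
    (Finset.le_sup (f := id) hx).trans_eq (hsec y)
  have hsub : ρ (a ⊓ (b ⊔ c)) ≤ ρ b ⊔ ρ c := by
    rw [← hρ b c, ← sup_eq_right, ← hρ, sup_eq_right.2 inf_le_right]
  rw [← hsec (a ⊓ (b ⊔ c))]
  refine Finset.sup_le fun x hx => ?_
  have hxa : x ≤ a := (le_of_mem hx).trans inf_le_left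
  rcases Finset.mem_union.1 (hsub hx) with hb | hc
  · exact le_sup_of_le_left (le_inf hxa (le_of_mem hb))
  · exact le_sup_of_le_right (le_inf hxa (le_of_mem hc))

/-- In a distributive lattice, join-irreducible elements are join-prime. -/
theorem SupIrred.supPrime_of_inf_sup_eq {M : Type*} [Lattice M]
    (hM : ∀ a b c : M, a ⊓ (b ⊔ c) = (a ⊓ b) ⊔ (a ⊓ c)) {p : M} (hp : SupIrred p) :
    SupPrime p := by
  refine ⟨hp.1, fun {a b} hab => ?_⟩
  have h := hM p a b
  rw [inf_eq_left.2 hab] at h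
  exact (hp.2 h.symm).imp inf_eq_left.1 inf_eq_left.1

/-- In a finite lattice, every element is the join of the join-irreducible elements below it. -/
theorem sup_supIrred_le_eq {M : Type*} [Lattice M] [Fintype M] [OrderBot M] (a : M)
    [DecidablePred fun p : M => SupIrred p ∧ p ≤ a] :
    (Finset.univ.filter fun p : M => SupIrred p ∧ p ≤ a).sup id = a := by
  refine le_antisymm (Finset.sup_le fun p hp => (Finset.mem_filter.1 hp).2.2) ?_
  obtain ⟨s, hs, hirr⟩ := exists_supIrred_decomposition a
  calc a = s.sup id := hs.symm
    _ ≤ _ := Finset.sup_mono fun p hp => Finset.mem_filter.2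
      ⟨Finset.mem_univ p, hirr hp, (Finset.le_sup (f := id) hp).trans_eq hs⟩

/-- A finite nonempty lattice `M` (a finite `B₁`-module), is projective as a
`B₁`-module iff it is distributive. Here `B₁`-modules are join-semilattices with a
least element, morphisms preserve binary joins and the least element, and `M` is
projective iff every morphism `φ : M → N₂` lifts through every surjective morphism
`ψ : N₁ → N₂`. -/
theorem stmt_6 (M : Type) [Lattice M] [Fintype M] [OrderBot M] :
    (∀ (N₁ N₂ : Type) [SemilatticeSup N₁] [OrderBot N₁] [SemilatticeSup N₂] [OrderBot N₂]
      (ψ : N₁ → N₂) (φ : M → N₂),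
      Function.Surjective ψ →
      (∀ a b : N₁, ψ (a ⊔ b) = ψ a ⊔ ψ b) → ψ ⊥ = ⊥ →
      (∀ a b : M, φ (a ⊔ b) = φ a ⊔ φ b) → φ ⊥ = ⊥ →
      ∃ ρ : M → N₁,
        (∀ a b : M, ρ (a ⊔ b) = ρ a ⊔ ρ b) ∧ ρ ⊥ = ⊥ ∧ ψ ∘ ρ = φ) ↔
    (∀ a b c : M, a ⊓ (b ⊔ c) = (a ⊓ b) ⊔ (a ⊓ c)) := by
  classical
  constructor
  · intro h
    obtain ⟨ρ, hρ, -, hsec⟩ := h (Finset M) M (fun s => s.sup id) id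
      (fun a => ⟨{a}, Finset.sup_singleton⟩) (fun _ _ => Finset.sup_union) Finset.sup_empty
      (fun _ _ => rfl) rfl
    exact inf_sup_eq_of_finset_sup_section ρ hρ (congrFun hsec)
  · intro hM N₁ N₂ _ _ _ _ ψ φ hψ hψsup hψbot hφsup hφbot
    let J : M → Finset M := fun a => Finset.univ.filter fun p => SupIrred p ∧ p ≤ a
    have hJsup : ∀ a b, J (a ⊔ b) = J a ∪ J b := fun a b => by
      ext p
      simp only [J, Finset.mem_union, Finset.mem_filter, Finset.mem_univ, true_and, ← and_or_left]
      exact and_congr_right fun hp => (hp.supPrime_of_inf_sup_eq hM).le_sup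
    have hJbot : J ⊥ = ∅ := Finset.filter_eq_empty_iff.2 fun p _ hp =>
      hp.1.ne_bot (le_bot_iff.1 hp.2)
    refine ⟨fun a => (J a).sup (Function.surjInv hψ ∘ φ), fun a b => ?_, ?_, funext fun a => ?_⟩
    · simp only [hJsup, Finset.sup_union]
    · simp only [hJbot, Finset.sup_empty]
    · calc ψ ((J a).sup (Function.surjInv hψ ∘ φ))
          = (J a).sup (ψ ∘ Function.surjInv hψ ∘ φ) :=
            Finset.apply_sup_eq_sup_comp ψ hψsup hψbot
        _ = (J a).sup (φ ∘ id) :=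
            Finset.sup_congr rfl fun p _ => Function.surjInv_eq hψ (φ p)
        _ = φ ((J a).sup id) := (Finset.apply_sup_eq_sup_comp φ hφsup hφbot).symm
        _ = φ a := congrArg φ (sup_supIrred_le_eq a)
end

section
/- There exists a finite B₁-module M whose associated lattice is modular, together with a sub-B₁-module N of M (a subset containing 0 and closed under +) such that the lattice associated to N is not modular (it is isomorphic to the five-element lattice N₅). Explicitly, M = {0, a, b, c, d, e} with idempotent commutative associative addition determined by a + b = d, c + d = e, b + c = c (and 0 neutral) is such an example, with N = {0, a, c, d, e}. -/
/-- A finite `B₁`-module, i.e. a finite (nonempty) lattice with least element. -/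
structure FinB1Mod where
  carrier : Type
  [lat : Lattice carrier]
  [fin : Fintype carrier]
  [bot : OrderBot carrier]

attribute [instance] FinB1Mod.lat FinB1Mod.fin FinB1Mod.bot

/-- The product of a two-element and a three-element chain with the atom `(0, 1)` removed;
it is closed under joins and isomorphic to the pentagon lattice `N₅`. -/
abbrev Pentagon : Type := {x : Fin 2 × Fin 3 // x ≠ (0, 1)}

/-- The lattice whose joins are computed in `Fin 2 × Fin 3`, and whose meets are computed
there except that the missing element `(0, 1)` is replaced by `(0, 0)`. -/
instance Pentagon.instLattice : Lattice Pentagon where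
  sup x y := ⟨x.1 ⊔ y.1, by revert x y; decide⟩
  le_sup_left := by decide
  le_sup_right := by decide
  sup_le := by decide
  inf x y := if h : x.1 ⊓ y.1 ≠ (0, 1) then ⟨x.1 ⊓ y.1, h⟩ else ⟨(0, 0), by decide⟩
  inf_le_left := by decide
  inf_le_right := by decide
  le_inf := by decide

instance Pentagon.instOrderBot : OrderBot Pentagon where
  bot := ⟨(0, 0), by decide⟩
  bot_le := by decide

theorem Pentagon.not_modular :
    ¬ ∀ a b c : Pentagon, a ≤ c → a ⊔ b ⊓ c = (a ⊔ b) ⊓ c := fun h =>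
  absurd (h ⟨(1, 0), by decide⟩ ⟨(0, 2), by decide⟩ ⟨(1, 1), by decide⟩ (by decide)) (by decide)

/-- There exists a finite `B₁`-module `M` (of cardinality 6) whose associated lattice
is modular, together with a sub-`B₁`-module `N` (of cardinality 5, embedded via an
injective map preserving the least element and binary joins) whose associated lattice
is not modular. -/
theorem stmt_8 :
    ∃ M : FinB1Mod, Fintype.card M.carrier = 6 ∧
      (∀ a b c : M.carrier, a ≤ c → a ⊔ b ⊓ c = (a ⊔ b) ⊓ c) ∧
      ∃ (N : FinB1Mod) (f : N.carrier → M.carrier),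
        Fintype.card N.carrier = 5 ∧
        Function.Injective f ∧ f ⊥ = ⊥ ∧
        (∀ a b : N.carrier, f (a ⊔ b) = f a ⊔ f b) ∧
        ¬ (∀ a b c : N.carrier, a ≤ c → a ⊔ b ⊓ c = (a ⊔ b) ⊓ c) := by
  exact ⟨⟨Fin 2 × Fin 3⟩, rfl, fun _ b _ h => (sup_inf_assoc_of_le b h).symm,
    ⟨Pentagon⟩, Subtype.val, rfl, Subtype.val_injective, rfl, fun _ _ => rfl,
    Pentagon.not_modular⟩
end

section
/- Let A be a finite set and ∼ a maximal congruence on the free B₁-algebra B₁[A]. Then the quotient B₁[A]/∼ is an integral domain in the following sense: for all u, v ∈ B₁[A], if uv ∼ 0 then u ∼ 0 or v ∼ 0. -/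
/-- Minkowski product on finite subsets of `ℕ^A`: `R·S = {a + b : a ∈ R, b ∈ S}`. -/
def mink {A : Type} [Fintype A] (R S : Finset (A → ℕ)) : Finset (A → ℕ) :=
  (R ×ˢ S).image fun p => p.1 + p.2

/-- A congruence on the free `B₁`-algebra `B₁[A] = 𝒫_f(ℕ^A)` (with union as addition
and Minkowski product as multiplication): an equivalence relation compatible with both
operations, with `0 = ∅` not congruent to `1 = {0}`. -/
def IsMinkCongr {A : Type} [Fintype A]
    (r : Finset (A → ℕ) → Finset (A → ℕ) → Prop) : Prop :=
  Equivalence r ∧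
  (∀ R S R' S' : Finset (A → ℕ), r R S → r R' S' → r (R ∪ R') (S ∪ S')) ∧
  (∀ R S R' S' : Finset (A → ℕ), r R S → r R' S' → r (mink R R') (mink S S')) ∧
  ¬ r ∅ {(0 : A → ℕ)}

/-- A maximal congruence: any congruence containing it equals it. -/
def IsMaximalMinkCongr {A : Type} [Fintype A]
    (r : Finset (A → ℕ) → Finset (A → ℕ) → Prop) : Prop :=
  IsMinkCongr r ∧
  ∀ r' : Finset (A → ℕ) → Finset (A → ℕ) → Prop,
    IsMinkCongr r' → (∀ R S, r R S → r' R S) → r' = r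

open scoped Pointwise

theorem mink_eq_add {A : Type} [Fintype A] (R S : Finset (A → ℕ)) : mink R S = R + S := rfl

/-- Pulling a congruence back along multiplication by an element `w` that is not congruent to
zero gives a congruence. -/
theorem IsMinkCongr.comap_mink {A : Type} [Fintype A]
    {r : Finset (A → ℕ) → Finset (A → ℕ) → Prop} (hr : IsMinkCongr r)
    {w : Finset (A → ℕ)} (hw : ¬ r w ∅) :
    IsMinkCongr fun R S => r (mink R w) (mink S w) := by
  obtain ⟨he, hadd, hmul, -⟩ := hr
  refine ⟨⟨fun _ => he.refl _, fun h => he.symm h, fun h h' => he.trans h h'⟩, ?_, ?_, ?_⟩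
  · intro R S R' S' h h'
    simpa only [mink_eq_add, Finset.union_add] using hadd _ _ _ _ h h'
  · intro R S R' S' h h'
    have h₁ := hmul _ _ _ _ h (he.refl R')
    have h₂ := hmul _ _ _ _ (he.refl S) h'
    simp only [mink_eq_add] at h₁ h₂ ⊢
    rw [add_right_comm R, add_right_comm S] at h₁
    rw [← add_assoc, ← add_assoc] at h₂
    exact he.trans h₁ h₂
  · intro h
    rw [mink_eq_add, mink_eq_add, Finset.empty_add, Finset.singleton_zero, zero_add] at h
    exact hw (he.symm h)

/-- If `∼` is a maximal congruence on the free `B₁`-algebra `B₁[A]`, then its quotient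
is an integral domain: `uv ∼ 0` implies `u ∼ 0` or `v ∼ 0`. -/
theorem stmt_12 (A : Type) [Fintype A]
    (r : Finset (A → ℕ) → Finset (A → ℕ) → Prop)
    (hr : IsMaximalMinkCongr r) :
    ∀ u v : Finset (A → ℕ), r (mink u v) ∅ → r u ∅ ∨ r v ∅ := by
  intro u v huv
  by_contra! ⟨hu, hv⟩
  have hcomap := hr.2 _ (hr.1.comap_mink hv) fun R S h =>
    hr.1.2.2.1 _ _ _ _ h (hr.1.1.refl v)
  rw [← hcomap] at hu
  beta_reduce at hu
  rw [mink_eq_add ∅, Finset.empty_add] at hu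
  exact hu huv
end

section
/- For every n ≥ 1, the map I ↦ ∼_I is a bijection from the set of subsets of {x₁, …, xₙ} onto the set of maximal congruences on the free B₁-algebra B₁[x₁, …, xₙ]; consequently MaxSpec(B₁[x₁, …, xₙ]), the set of maximal congruences on B₁[x₁, …, xₙ], has cardinality exactly 2ⁿ. -/
/-- `F_I(R) = {r ∈ R : r(x) = 0 for all x ∈ I}`. -/
def FI {A : Type} [Fintype A] (I : Finset A) (R : Finset (A → ℕ)) : Finset (A → ℕ) :=
  R.filter fun r => ∀ x ∈ I, r x = 0

/-- `R ∼_I S` iff `F_I(R)` and `F_I(S)` are both empty or both nonempty. -/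
def simI {A : Type} [Fintype A] (I : Finset A) (R S : Finset (A → ℕ)) : Prop :=
  (FI I R = ∅ ∧ FI I S = ∅) ∨ (FI I R ≠ ∅ ∧ FI I S ≠ ∅)

section Mink

variable {A : Type}

/-- `R` contains a monomial in which no variable of `I` occurs. -/
def HasFree (I : Finset A) (R : Finset (A → ℕ)) : Prop :=
  ∃ t ∈ R, ∀ x ∈ I, t x = 0

lemma not_hasFree_empty (I : Finset A) : ¬ HasFree I ∅ := by simp [HasFree]

lemma hasFree_zero (I : Finset A) : HasFree I {(0 : A → ℕ)} := by simp [HasFree]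

lemma hasFree_single [DecidableEq A] {I : Finset A} {x : A} :
    HasFree I {Pi.single x 1} ↔ x ∉ I := by
  simp only [HasFree, Finset.mem_singleton, exists_eq_left]
  constructor
  · intro h hx
    simpa using h x hx
  · intro h y hy
    exact Pi.single_eq_of_ne (ne_of_mem_of_not_mem hy h) 1

variable [Fintype A]

lemma mem_mink {R S : Finset (A → ℕ)} {t : A → ℕ} :
    t ∈ mink R S ↔ ∃ a ∈ R, ∃ b ∈ S, a + b = t := by
  simp only [mink, Finset.mem_image, Finset.mem_product, Prod.exists]
  exact ⟨fun ⟨a, b, ⟨ha, hb⟩, h⟩ => ⟨a, ha, b, hb, h⟩,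
    fun ⟨a, ha, b, hb, h⟩ => ⟨a, b, ⟨ha, hb⟩, h⟩⟩

lemma FI_ne_empty_iff {I : Finset A} {R : Finset (A → ℕ)} :
    FI I R ≠ ∅ ↔ HasFree I R := by
  rw [← Finset.nonempty_iff_ne_empty, FI, Finset.filter_nonempty_iff, HasFree]

lemma simI_iff {I : Finset A} {R S : Finset (A → ℕ)} :
    simI I R S ↔ (HasFree I R ↔ HasFree I S) := by
  rw [← FI_ne_empty_iff, ← FI_ne_empty_iff, simI]
  tauto

lemma hasFree_union {I : Finset A} {R S : Finset (A → ℕ)} :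
    HasFree I (R ∪ S) ↔ HasFree I R ∨ HasFree I S := by
  simp only [HasFree, Finset.mem_union, or_and_right, exists_or]

lemma hasFree_mink {I : Finset A} {R S : Finset (A → ℕ)} :
    HasFree I (mink R S) ↔ HasFree I R ∧ HasFree I S := by
  constructor
  · rintro ⟨t, ht, h⟩
    obtain ⟨a, ha, b, hb, rfl⟩ := mem_mink.1 ht
    exact ⟨⟨a, ha, fun x hx => (Nat.add_eq_zero_iff.1 (h x hx)).1⟩,
      ⟨b, hb, fun x hx => (Nat.add_eq_zero_iff.1 (h x hx)).2⟩⟩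
  · rintro ⟨⟨a, ha, h⟩, b, hb, h'⟩
    exact ⟨a + b, mem_mink.2 ⟨a, ha, b, hb, rfl⟩, fun x hx => by simp [h x hx, h' x hx]⟩

lemma isMinkCongr_simI (I : Finset A) : IsMinkCongr (simI I) := by
  refine ⟨⟨fun R => ?_, fun {R S} h => ?_, fun {R S T} h h' => ?_⟩,
    fun R S R' S' h h' => ?_, fun R S R' S' h h' => ?_, fun h => ?_⟩
  · exact simI_iff.2 Iff.rfl
  · exact simI_iff.2 (simI_iff.1 h).symm
  · exact simI_iff.2 ((simI_iff.1 h).trans (simI_iff.1 h'))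
  · rw [simI_iff] at *
    rw [hasFree_union, hasFree_union, h, h']
  · rw [simI_iff] at *
    rw [hasFree_mink, hasFree_mink, h, h']
  · exact not_hasFree_empty I ((simI_iff.1 h).2 (hasFree_zero I))

lemma eq_of_simI_le {I J : Finset A} (h : ∀ R S, simI I R S → simI J R S) : I = J := by
  classical
  ext x
  constructor
  · intro hx
    have key := simI_iff.1 (h {Pi.single x 1} ∅ (simI_iff.2
      (iff_of_false (fun h => hasFree_single.1 h hx) (not_hasFree_empty I))))
    by_contra hJ
    exact not_hasFree_empty J (key.1 (hasFree_single.2 hJ))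
  · intro hx
    by_contra hI
    have key := simI_iff.1 (h {Pi.single x 1} {0} (simI_iff.2
      (iff_of_true (hasFree_single.2 hI) (hasFree_zero I))))
    exact hasFree_single.1 (key.2 (hasFree_zero J)) hx

namespace IsMinkCongr

variable {r : Finset (A → ℕ) → Finset (A → ℕ) → Prop}

/-- The preorder induced by a congruence from the order of the quotient. -/
def Below (r : Finset (A → ℕ) → Finset (A → ℕ) → Prop) (R S : Finset (A → ℕ)) : Prop :=
  r (R ∪ S) S

lemma below_of_subset (hr : IsMinkCongr r) {R S : Finset (A → ℕ)} (h : R ⊆ S) :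
    Below r R S := by
  rw [Below, Finset.union_eq_right.2 h]
  exact hr.1.refl S

lemma below_of_rel (hr : IsMinkCongr r) {R S : Finset (A → ℕ)} (h : r R S) :
    Below r R S := by
  simpa [Below] using hr.2.1 _ _ _ _ h (hr.1.refl S)

lemma below_trans (hr : IsMinkCongr r) {R S T : Finset (A → ℕ)}
    (h : Below r R S) (h' : Below r S T) : Below r R T := by
  have h₁ : r (R ∪ (S ∪ T)) (R ∪ T) := hr.2.1 _ _ _ _ (hr.1.refl R) h'
  have h₂ : r (R ∪ S ∪ T) (S ∪ T) := hr.2.1 _ _ _ _ h (hr.1.refl T)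
  rw [Finset.union_assoc] at h₂
  exact hr.1.trans (hr.1.symm h₁) (hr.1.trans h₂ h')

lemma below_union (hr : IsMinkCongr r) {R S R' S' : Finset (A → ℕ)}
    (h : Below r R S) (h' : Below r R' S') : Below r (R ∪ R') (S ∪ S') := by
  rw [Below, Finset.union_union_union_comm]
  exact hr.2.1 _ _ _ _ h h'

lemma below_mink (hr : IsMinkCongr r) {R S R' S' : Finset (A → ℕ)}
    (h : Below r R S) (h' : Below r R' S') : Below r (mink R R') (mink S S') := by
  refine hr.below_trans (hr.below_of_subset ?_) (hr.below_of_rel (hr.2.2.1 _ _ _ _ h h'))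
  intro t ht
  obtain ⟨a, ha, b, hb, rfl⟩ := mem_mink.1 ht
  exact mem_mink.2 ⟨a, Finset.mem_union_left _ ha, b, Finset.mem_union_left _ hb, rfl⟩

/-- `1` lies in the saturated ideal generated by the variables of `I` and the monomial `s`. -/
def UnitBelow (r : Finset (A → ℕ) → Finset (A → ℕ) → Prop) (I : Finset A) (s : A → ℕ) : Prop :=
  ∃ T, Below r {0} T ∧ ∀ t ∈ T, (∀ x ∈ I, t x = 0) → s ≤ t

lemma unitBelow_zero (hr : IsMinkCongr r) (I : Finset A) : UnitBelow r I 0 :=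
  ⟨{0}, hr.below_of_subset subset_rfl, fun _ _ _ => zero_le⟩

lemma unitBelow_add (hr : IsMinkCongr r) {I : Finset A} {s s' : A → ℕ}
    (h : UnitBelow r I s) (h' : UnitBelow r I s') : UnitBelow r I (s + s') := by
  obtain ⟨T, hT, hs⟩ := h
  obtain ⟨T', hT', hs'⟩ := h'
  refine ⟨mink T T', ?_, fun t ht h0 => ?_⟩
  · have := hr.below_mink hT hT'
    simpa [mink] using this
  · obtain ⟨a, ha, b, hb, rfl⟩ := mem_mink.1 ht
    exact add_le_add (hs a ha fun x hx => (Nat.add_eq_zero_iff.1 (h0 x hx)).1)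
      (hs' b hb fun x hx => (Nat.add_eq_zero_iff.1 (h0 x hx)).2)

lemma unitBelow_of_single [DecidableEq A] (hr : IsMinkCongr r) {I : Finset A} {s : A → ℕ}
    (hs : ∀ x, s x ≠ 0 → UnitBelow r I (Pi.single x 1)) : UnitBelow r I s := by
  rw [← Finset.univ_sum_single s]
  refine Finset.sum_induction _ (UnitBelow r I) (fun _ _ => hr.unitBelow_add)
    (hr.unitBelow_zero I) fun x _ => ?_
  by_cases hx : s x = 0
  · rw [hx, Pi.single_zero]
    exact hr.unitBelow_zero I
  have hmul : ∀ k : ℕ, UnitBelow r I (Pi.single x k) := by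
    intro k
    induction k with
    | zero => simpa using hr.unitBelow_zero I
    | succ k ih =>
      rw [Pi.single_add]
      exact hr.unitBelow_add ih (hs x hx)
  exact hmul _

/-- If `1` lies in the saturated ideal generated by `I` and `s`, everything above `s` has a free monomial,
provided `1` is not in the saturated ideal generated by `I`. -/
lemma hasFree_of_unitBelow (hr : IsMinkCongr r) {I : Finset A}
    (hI : ∀ T, Below r {0} T → HasFree I T) {s : A → ℕ} (hs : UnitBelow r I s)
    {R : Finset (A → ℕ)} (hR : Below r {s} R) : HasFree I R := by
  obtain ⟨T, hT, hsT⟩ := hs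
  let U := T.filter fun t => ¬ ∀ x ∈ I, t x = 0
  let W := (FI I T).image fun t => t - s
  have hsub : T ⊆ U ∪ mink {s} W := by
    intro t ht
    by_cases h : ∀ x ∈ I, t x = 0
    · refine Finset.mem_union_right _ (mem_mink.2 ⟨s, Finset.mem_singleton_self s, t - s,
        Finset.mem_image_of_mem _ (Finset.mem_filter.2 ⟨ht, h⟩), ?_⟩)
      exact add_tsub_cancel_of_le (hsT t ht h)
    · exact Finset.mem_union_left _ (Finset.mem_filter.2 ⟨ht, h⟩)
  have hbelow : Below r {0} (U ∪ mink R W) :=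
    hr.below_trans hT (hr.below_trans (hr.below_of_subset hsub)
      (hr.below_union (hr.below_of_subset subset_rfl)
        (hr.below_mink hR (hr.below_of_subset subset_rfl))))
  rcases hasFree_union.1 (hI _ hbelow) with ⟨t, ht, h⟩ | h
  · exact absurd h (Finset.mem_filter.1 ht).2
  · exact (hasFree_mink.1 h).1

/-- Every congruence is contained in some `∼_I`. -/
lemma exists_le_simI (hr : IsMinkCongr r) : ∃ I : Finset A, ∀ R S, r R S → simI I R S := by
  classical
  have hempty : ∀ T, Below r {0} T → HasFree ∅ T := by
    intro T hT
    rcases T.eq_empty_or_nonempty with rfl | ⟨t, ht⟩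
    · exact absurd (hr.1.symm (by simpa [Below] using hT)) hr.2.2.2
    · exact ⟨t, ht, by simp⟩
  obtain ⟨I, hI⟩ := Set.Finite.exists_maximal
    (Set.toFinite {I : Finset A | ∀ T, Below r {0} T → HasFree I T}) ⟨∅, hempty⟩
  have hsingle : ∀ x ∉ I, UnitBelow r I (Pi.single x 1) := by
    intro x hx
    by_contra hcon
    refine hx (hI.2 (y := insert x I) (fun T hT => ?_) (Finset.subset_insert x I)
      (Finset.mem_insert_self x I))
    by_contra hfree
    refine hcon ⟨T, hT, fun t ht h0 => ?_⟩
    have htx : t x ≠ 0 := fun h => hfree ⟨t, ht, fun y hy => by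
      rcases Finset.mem_insert.1 hy with rfl | hy
      exacts [h, h0 y hy]⟩
    intro y
    by_cases hy : y = x
    · subst hy
      simpa using Nat.one_le_iff_ne_zero.2 htx
    · simp [hy]
  have himp : ∀ R S, r R S → HasFree I R → HasFree I S := by
    rintro R S h ⟨s, hsR, hs⟩
    refine hr.hasFree_of_unitBelow hI.1
      (hr.unitBelow_of_single fun x hx => hsingle x fun hxI => hx (hs x hxI))
      (hr.below_trans (hr.below_of_subset (Finset.singleton_subset_iff.2 hsR))
        (hr.below_of_rel h))
  exact ⟨I, fun R S h => simI_iff.2 ⟨himp R S h, himp S R (hr.1.symm h)⟩⟩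

end IsMinkCongr

lemma isMaximalMinkCongr_simI (I : Finset A) : IsMaximalMinkCongr (simI I) := by
  refine ⟨isMinkCongr_simI I, fun r hr hle => ?_⟩
  obtain ⟨J, hJ⟩ := hr.exists_le_simI
  obtain rfl := eq_of_simI_le fun R S h => hJ R S (hle R S h)
  ext R S
  exact ⟨hJ R S, hle R S⟩

lemma simI_injective : Function.Injective (fun I : Finset A => simI I) := by
  intro I J h
  exact eq_of_simI_le fun R S hRS => (congrFun (congrFun h R) S).mp hRS

lemma IsMaximalMinkCongr.exists_eq_simI {r : Finset (A → ℕ) → Finset (A → ℕ) → Prop}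
    (hr : IsMaximalMinkCongr r) : ∃ I : Finset A, r = simI I := by
  obtain ⟨I, hI⟩ := hr.1.exists_le_simI
  exact ⟨I, (hr.2 _ (isMinkCongr_simI I) hI).symm⟩

lemma card_isMaximalMinkCongr :
    Nat.card {r : Finset (A → ℕ) → Finset (A → ℕ) → Prop // IsMaximalMinkCongr r} =
      2 ^ Fintype.card A := by
  rw [← Fintype.card_finset, ← Nat.card_eq_fintype_card]
  refine (Nat.card_eq_of_bijective
    (fun I : Finset A => (⟨simI I, isMaximalMinkCongr_simI I⟩ : {r // IsMaximalMinkCongr r}))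
    ⟨fun I J h => simI_injective (congrArg Subtype.val h), ?_⟩).symm
  rintro ⟨r, hr⟩
  obtain ⟨I, rfl⟩ := hr.exists_eq_simI
  exact ⟨I, rfl⟩

end Mink

/-- For `n ≥ 1`, `I ↦ ∼_I` is a bijection from subsets of an `n`-element set onto the
maximal congruences of `B₁[x₁, …, xₙ]`; consequently `MaxSpec(B₁[x₁, …, xₙ])` has
cardinality `2^n`. -/
theorem stmt_14 (n : ℕ) (hn : 1 ≤ n) :
    (∀ I : Finset (Fin n), IsMaximalMinkCongr (simI I)) ∧
    Function.Injective (fun I : Finset (Fin n) => simI I) ∧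
    (∀ r : Finset (Fin n → ℕ) → Finset (Fin n → ℕ) → Prop,
      IsMaximalMinkCongr r → ∃ I : Finset (Fin n), r = simI I) ∧
    Nat.card {r : Finset (Fin n → ℕ) → Finset (Fin n → ℕ) → Prop //
      IsMaximalMinkCongr r} = 2 ^ n := by
  exact ⟨isMaximalMinkCongr_simI, simI_injective, fun _ hr => hr.exists_eq_simI,
    by simpa using card_isMaximalMinkCongr (A := Fin n)⟩
end

section
/- Let A and B be abelian groups (written multiplicatively). Then every semiring homomorphism ψ : ℱ(A) → ℱ(B) is of the form ℱ(φ) for a unique group homomorphism φ : A → B, i.e., ψ(C) = {φ(c) : c ∈ C} for all finite C ⊆ A; hence the natural map Hom(A, B) → Hom_{B₁-alg}(ℱ(A), ℱ(B)), φ ↦ ℱ(φ), is a bijection. (The functor ℱ restricted to abelian groups is fully faithful.) -/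
/-- The product `B·C = {xy : x ∈ B, y ∈ C}` on finite subsets of a commutative
monoid. -/
def fprod {A : Type*} [CommMonoid A] [DecidableEq A] (B C : Finset A) : Finset A :=
  (B ×ˢ C).image fun p => p.1 * p.2

theorem fprod_singleton {A : Type*} [CommMonoid A] [DecidableEq A] (x y : A) :
    fprod {x} {y} = {x * y} := by
  simp [fprod]

theorem exists_eq_singleton_of_fprod_eq_one {B : Type*} [CommGroup B] [DecidableEq B]
    {S T : Finset B} (h : fprod S T = {1}) : ∃ b, S = {b} := by
  have hST : ∀ s ∈ S, ∀ t ∈ T, s * t = 1 := fun s hs t ht => by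
    have hmem : s * t ∈ fprod S T :=
      Finset.mem_image.2 ⟨(s, t), Finset.mk_mem_product hs ht, rfl⟩
    simpa [h] using hmem
  have hone : (1 : B) ∈ fprod S T := by simp [h]
  obtain ⟨⟨s, t⟩, hst, -⟩ := Finset.mem_image.1 hone
  obtain ⟨hs, ht⟩ := Finset.mem_product.1 hst
  exact ⟨s, Finset.eq_singleton_iff_unique_mem.2
    ⟨hs, fun x hx => mul_right_cancel ((hST x hx t ht).trans (hST s hs t ht).symm)⟩⟩

/-- `ℱ` is fully faithful on abelian groups: for abelian groups `A`, `B`, every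
semiring homomorphism `ψ : ℱ(A) → ℱ(B)` (where `ℱ(X) = 𝒫_f(X)` with union as addition
and `{xy}` as multiplication) is of the form `ℱ(φ) : C ↦ φ[C]` for a unique group
homomorphism `φ : A → B`. -/
theorem stmt_17 (A B : Type) [CommGroup A] [DecidableEq A] [CommGroup B] [DecidableEq B]
    (ψ : Finset A → Finset B)
    (hadd : ∀ C D : Finset A, ψ (C ∪ D) = ψ C ∪ ψ D)
    (hzero : ψ ∅ = ∅)
    (hmul : ∀ C D : Finset A, ψ (fprod C D) = fprod (ψ C) (ψ D))
    (hone : ψ {(1 : A)} = {(1 : B)}) :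
    ∃! φ : A → B,
      (φ 1 = 1 ∧ ∀ x y : A, φ (x * y) = φ x * φ y) ∧
      ∀ C : Finset A, ψ C = C.image φ := by
  have hsingle : ∀ a : A, ∃ b : B, ψ {a} = {b} := fun a =>
    exists_eq_singleton_of_fprod_eq_one (T := ψ {a⁻¹}) <| by
      rw [← hmul, fprod_singleton, mul_inv_cancel, hone]
  choose φ hφ using hsingle
  refine ⟨φ, ⟨⟨?_, fun x y => ?_⟩, fun C => ?_⟩, fun φ' h => ?_⟩
  · exact Finset.singleton_injective ((hφ 1).symm.trans hone)
  · apply Finset.singleton_injective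
    rw [← hφ, ← fprod_singleton, hmul, hφ, hφ, fprod_singleton]
  · induction C using Finset.induction_on with
    | empty => simpa using hzero
    | insert a s _ ih =>
      rw [Finset.insert_eq, hadd, hφ, ih, Finset.image_union, Finset.image_singleton]
  · funext a
    apply Finset.singleton_injective
    rw [← hφ, h.2, Finset.image_singleton]
end
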